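/- Let F(U,V) = aU³ + bU²V + cUV² + dV³ be a binary cubic form with integer coefficients, irreducible over ℚ, whose discriminant D(F) = 18abcd − 4b³d + b²c² − 4ac³ − 27a²d² is negative. Then the number of pairs (u,v) ∈ ℤ² with F(u,v) = ±1, counted up to the identification of (u,v) with (−u,−v), is at most 5. -/

import Mathlib

/-- The value of the binary cubic form `aU³ + bU²V + cUV² + dV³` at a pair. -/
def cubicFormVal (a b c d : ℤ) (p : ℤ × ℤ) : ℤ :=
  a * p.1 ^ 3 + b * p.1 ^ 2 * p.2 + c * p.1 * p.2 ^ 2 + d * p.2 ^ 3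

/-- Solutions of the Thue equation `F(U,V) = ±1`. -/
abbrev CubicThueSol (a b c d : ℤ) : Type :=
  {p : ℤ × ℤ // cubicFormVal a b c d p = 1 ∨ cubicFormVal a b c d p = -1}

/-- Identification of a solution `(u,v)` with `(-u,-v)`. -/
def pmRelCubic (a b c d : ℤ) (p q : CubicThueSol a b c d) : Prop :=
  (p : ℤ × ℤ) = (q : ℤ × ℤ) ∨ (p : ℤ × ℤ) = -(q : ℤ × ℤ)

/-- The discriminant of the binary cubic form `aU³ + bU²V + cUV² + dV³`. -/
def cubicDisc (a b c d : ℤ) : ℤ :=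
  18 * a * b * c * d - 4 * b ^ 3 * d + b ^ 2 * c ^ 2 - 4 * a * c ^ 3 -
    27 * a ^ 2 * d ^ 2

/-- The subring `ℤ + ℤθ + ℤθ²` of `ℝ`, for a root `θ` of a monic integral cubic. -/
def cubicOrder (b c d : ℤ) (θ : ℝ) (hθ : θ ^ 3 + b * θ ^ 2 + c * θ + d = 0) : Subring ℝ where
  carrier := {r | ∃ x y z : ℤ, r = x + y * θ + z * θ ^ 2}
  mul_mem' := by
    rintro _ _ ⟨x, y, z, rfl⟩ ⟨X, Y, Z, rfl⟩
    refine ⟨x * X - d * (y * Z + z * Y - b * z * Z),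
      x * Y + y * X - c * (y * Z + z * Y) + (b * c - d) * (z * Z),
      x * Z + y * Y + z * X - b * (y * Z + z * Y) + (b ^ 2 - c) * (z * Z), ?_⟩
    push_cast
    linear_combination (z * Z * θ + (y * Z + z * Y - b * z * Z)) * hθ
  one_mem' := ⟨1, 0, 0, by simp⟩
  add_mem' := by
    rintro _ _ ⟨x, y, z, rfl⟩ ⟨X, Y, Z, rfl⟩
    exact ⟨x + X, y + Y, z + Z, by push_cast; ring⟩
  zero_mem' := ⟨0, 0, 0, by simp⟩
  neg_mem' := by
    rintro _ ⟨x, y, z, rfl⟩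
    exact ⟨-x, -y, -z, by push_cast; ring⟩

/-- The numbers `1, w, w²` are linearly independent over `ℤ`. -/
def IndepPowers (w : ℝ) : Prop :=
  ∀ x y z : ℤ, (x : ℝ) + y * w + z * w ^ 2 = 0 → x = 0 ∧ y = 0 ∧ z = 0

theorem IndepPowers.ext {w : ℝ} (hw : IndepPowers w) {x y z X Y Z : ℤ}
    (h : (x : ℝ) + y * w + z * w ^ 2 = X + Y * w + Z * w ^ 2) : x = X ∧ y = Y ∧ z = Z := by
  have := hw (x - X) (y - Y) (z - Z) (by push_cast; linear_combination h)
  omega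

/-- The norm of `x + yθ + zθ²`, where `θ³ + bθ² + cθ + d = 0`. -/
def cubicNorm (b c d x y z : ℤ) : ℤ :=
  x * ((x - c * z) * (x - c * z - b * (y - b * z)) - (y - b * z) * (-d * z - c * (y - b * z)))
    - y * (-d * z * (x - c * z - b * (y - b * z)) + d * (y - b * z) ^ 2)
    + z * (-d * z * (-d * z - c * (y - b * z)) + d * (y - b * z) * (x - c * z))

/-- The product of the two other conjugates of `x + yθ + zθ²`. -/
noncomputable def cubicCofactor (b c : ℤ) (θ x y z : ℝ) : ℝ :=
  (x + y * (-b - θ) / 2 + z * ((-b - θ) ^ 2 / 2 - (c + b * θ + θ ^ 2))) ^ 2 +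
    (4 * (c + b * θ + θ ^ 2) - (-b - θ) ^ 2) / 4 * (y + (-b - θ) * z) ^ 2

theorem mul_cubicCofactor {b c d : ℤ} {θ : ℝ} (hθ : θ ^ 3 + b * θ ^ 2 + c * θ + d = 0)
    (x y z : ℤ) :
    (x + y * θ + z * θ ^ 2) * cubicCofactor b c θ x y z = cubicNorm b c d x y z := by
  have h : (d : ℝ) = -(θ ^ 3 + b * θ ^ 2 + c * θ) := by linarith
  simp only [cubicCofactor, cubicNorm]
  push_cast
  rw [h]
  ring

theorem cubicNorm_mul (b c d x y z X Y Z : ℤ) :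
    cubicNorm b c d (x * X - d * (y * Z + z * Y - b * z * Z))
      (x * Y + y * X - c * (y * Z + z * Y) + (b * c - d) * (z * Z))
      (x * Z + y * Y + z * X - b * (y * Z + z * Y) + (b ^ 2 - c) * (z * Z)) =
    cubicNorm b c d x y z * cubicNorm b c d X Y Z := by
  simp only [cubicNorm]
  ring

theorem four_mul_sub_sq_pos {b c d : ℤ} {θ : ℝ} (hθ : θ ^ 3 + b * θ ^ 2 + c * θ + d = 0)
    (hdisc : cubicDisc 1 b c d < 0) :
    0 < 4 * (c + b * θ + θ ^ 2) - (-b - θ) ^ 2 ∧ 3 * θ ^ 2 + 2 * b * θ + c ≠ 0 := by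
  have h : (d : ℝ) = -(θ ^ 3 + b * θ ^ 2 + c * θ) := by linarith
  have h1 : ((cubicDisc 1 b c d : ℤ) : ℝ) =
      -(4 * (c + b * θ + θ ^ 2) - (-b - θ) ^ 2) * (3 * θ ^ 2 + 2 * b * θ + c) ^ 2 := by
    simp only [cubicDisc]
    push_cast
    rw [h]
    ring
  have h2 : ((cubicDisc 1 b c d : ℤ) : ℝ) < 0 := by exact_mod_cast hdisc
  rw [h1] at h2
  constructor
  · by_contra! h3
    nlinarith [mul_nonneg (neg_nonneg.2 h3) (sq_nonneg (3 * θ ^ 2 + 2 * b * θ + c))]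
  · intro h3
    simp [h3] at h2

/-- A positive unit `u` of the order has cofactor `1/u`. -/
theorem cubicCofactor_eq_inv {b c d : ℤ} {θ : ℝ} (hθ : θ ^ 3 + b * θ ^ 2 + c * θ + d = 0)
    (hdisc : cubicDisc 1 b c d < 0) (hind : IndepPowers θ) {x y z : ℤ}
    (hpos : 0 < x + y * θ + z * θ ^ 2)
    (hinv : (x + y * θ + z * θ ^ 2)⁻¹ ∈ cubicOrder b c d θ hθ) :
    (x + y * θ + z * θ ^ 2) * cubicCofactor b c θ x y z = 1 := by
  obtain ⟨X, Y, Z, hv⟩ := hinv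
  have h1 := mul_inv_cancel₀ hpos.ne'
  rw [hv] at h1
  have h2 : ((x * X - d * (y * Z + z * Y - b * z * Z) : ℤ) : ℝ) +
      (x * Y + y * X - c * (y * Z + z * Y) + (b * c - d) * (z * Z) : ℤ) * θ +
      (x * Z + y * Y + z * X - b * (y * Z + z * Y) + (b ^ 2 - c) * (z * Z) : ℤ) * θ ^ 2 =
      (1 : ℤ) + (0 : ℤ) * θ + (0 : ℤ) * θ ^ 2 := by
    push_cast
    linear_combination h1 - (z * Z * θ + (y * Z + z * Y - b * z * Z)) * hθ
  obtain ⟨e1, e2, e3⟩ := hind.ext h2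
  have h3 := cubicNorm_mul b c d x y z X Y Z
  rw [e1, e2, e3] at h3
  have h4 : cubicNorm b c d 1 0 0 = 1 := by simp [cubicNorm]
  rw [h4] at h3
  rw [mul_cubicCofactor hθ]
  have h5 : (0 : ℝ) ≤ cubicNorm b c d x y z := by
    rw [← mul_cubicCofactor hθ]
    refine mul_nonneg hpos.le (add_nonneg (sq_nonneg _) (mul_nonneg ?_ (sq_nonneg _)))
    linarith [(four_mul_sub_sq_pos hθ hdisc).1]
  have h6 : 0 ≤ cubicNorm b c d x y z := by exact_mod_cast h5
  have h7 := Int.eq_one_or_neg_one_of_mul_eq_one h3.symm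
  have h8 : cubicNorm b c d x y z = 1 := by omega
  simp [h8]

/-- The logarithms of the positive units of the order. -/
def logUnits (b c d : ℤ) (θ : ℝ) (hθ : θ ^ 3 + b * θ ^ 2 + c * θ + d = 0) :
    AddSubgroup ℝ where
  carrier := {l | Real.exp l ∈ cubicOrder b c d θ hθ ∧ Real.exp (-l) ∈ cubicOrder b c d θ hθ}
  add_mem' := by
    rintro l m ⟨h1, h2⟩ ⟨h3, h4⟩
    refine ⟨?_, ?_⟩
    · rw [Real.exp_add]
      exact mul_mem h1 h3
    · rw [neg_add, Real.exp_add]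
      exact mul_mem h2 h4
  zero_mem' := by simp [one_mem]
  neg_mem' := by
    rintro l ⟨h1, h2⟩
    exact ⟨h2, by simpa using h1⟩

theorem abs_coeffs_le {b c : ℤ} {θ M : ℝ} (hδ : 0 < 4 * (c + b * θ + θ ^ 2) - (-b - θ) ^ 2)
    (hf : 3 * θ ^ 2 + 2 * b * θ + c ≠ 0) (hM : 0 ≤ M) :
    ∃ K : ℝ, ∀ x y z : ℝ, |x + y * θ + z * θ ^ 2| ≤ M → cubicCofactor b c θ x y z ≤ M →
      |x| ≤ K ∧ |y| ≤ K ∧ |z| ≤ K := by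
  set δ := (4 * (c + b * θ + θ ^ 2) - (-b - θ) ^ 2) / 4 with hδd
  have hδ' : 0 < δ := by positivity
  set g := 3 * θ ^ 2 + 2 * b * θ + c with hg
  set N := M + (M + 1) + (M / δ + 1) * |θ - (-b - θ) / 2| with hN
  refine ⟨N / |g| + (M / δ + 1 + |(-b - θ)| * (N / |g|)) +
    (M + (M / δ + 1 + |(-b - θ)| * (N / |g|)) * |θ| + (N / |g|) * θ ^ 2), ?_⟩
  intro x y z h1 h2
  set A := y + (-b - θ) * z with hA
  set B := x + y * (-b - θ) / 2 + z * ((-b - θ) ^ 2 / 2 - (c + b * θ + θ ^ 2)) with hB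
  have h3 : B ^ 2 + δ * A ^ 2 ≤ M := h2
  have hg0 : 0 < |g| := abs_pos.2 hf
  have hsq : ∀ r s : ℝ, r ^ 2 ≤ s → |r| ≤ s + 1 := fun r s h => by
    rw [← sq_abs] at h
    nlinarith [sq_nonneg (|r| - 1)]
  have hB1 : |B| ≤ M + 1 := hsq _ _ (by nlinarith [mul_nonneg hδ'.le (sq_nonneg A)])
  have hA1 : |A| ≤ M / δ + 1 := hsq _ _ (by
    rw [le_div_iff₀ hδ']
    nlinarith [sq_nonneg B])
  have hN0 : 0 ≤ N := by positivity
  have hz : |z| ≤ N / |g| := by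
    rw [le_div_iff₀ hg0, ← abs_mul]
    have : z * g = (x + y * θ + z * θ ^ 2) - B - A * (θ - (-b - θ) / 2) := by
      simp only [hg, hA, hB]
      ring
    rw [this]
    calc _ ≤ |x + y * θ + z * θ ^ 2| + |B| + |A| * |θ - (-b - θ) / 2| := by
          rw [← abs_mul]
          exact (abs_sub _ _).trans (by gcongr; exact abs_sub _ _)
      _ ≤ N := by
          rw [hN]
          gcongr
  have hy : |y| ≤ M / δ + 1 + |(-b - θ)| * (N / |g|) := by
    have : y = A - (-b - θ) * z := by rw [hA]; ring
    rw [this]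
    refine (abs_sub _ _).trans ?_
    rw [abs_mul]
    gcongr
  have hx : |x| ≤ M + (M / δ + 1 + |(-b - θ)| * (N / |g|)) * |θ| + (N / |g|) * θ ^ 2 := by
    have : x = (x + y * θ + z * θ ^ 2) - y * θ - z * θ ^ 2 := by ring
    rw [this]
    refine (abs_sub _ _).trans ?_
    rw [abs_mul z, abs_of_nonneg (sq_nonneg θ)]
    gcongr
    refine (abs_sub _ _).trans ?_
    rw [abs_mul y]
    gcongr
  have p1 : 0 ≤ N / |g| := by positivity
  have p2 := (abs_nonneg y).trans hy
  have p3 := (abs_nonneg x).trans hx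
  refine ⟨?_, ?_, ?_⟩ <;> linarith

theorem finite_logUnits_Ioo {b c d : ℤ} {θ : ℝ} (hθ : θ ^ 3 + b * θ ^ 2 + c * θ + d = 0)
    (hdisc : cubicDisc 1 b c d < 0) (hind : IndepPowers θ) :
    ((logUnits b c d θ hθ : Set ℝ) ∩ Set.Ioo 0 1).Finite := by
  obtain ⟨hδ, hf⟩ := four_mul_sub_sq_pos hθ hdisc
  obtain ⟨K, hK⟩ := abs_coeffs_le (M := 3) hδ hf (by norm_num)
  have hfin : (Set.Icc (-⌊K⌋) ⌊K⌋ ×ˢ Set.Icc (-⌊K⌋) ⌊K⌋ ×ˢ Set.Icc (-⌊K⌋) ⌊K⌋ :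
      Set (ℤ × ℤ × ℤ)).Finite :=
    (Set.finite_Icc _ _).prod ((Set.finite_Icc _ _).prod (Set.finite_Icc _ _))
  refine (hfin.image fun p => Real.log (p.1 + p.2.1 * θ + p.2.2 * θ ^ 2)).subset ?_
  rintro l ⟨⟨⟨x, y, z, h1⟩, h2⟩, h3, h4⟩
  have hpos := Real.exp_pos l
  have hgt : 1 < Real.exp l := Real.one_lt_exp_iff.2 h3
  have hlt : Real.exp l < 3 :=
    (Real.exp_lt_exp.2 h4).trans (Real.exp_one_lt_d9.trans (by norm_num))
  rw [Real.exp_neg, h1] at h2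
  rw [h1] at hpos hgt hlt
  have h5 := cubicCofactor_eq_inv hθ hdisc hind hpos h2
  have h6 : cubicCofactor b c θ x y z ≤ 3 := by
    by_contra! h
    nlinarith
  obtain ⟨hx, hy, hz⟩ := hK x y z (by rw [abs_of_pos hpos]; exact hlt.le) h6
  have hcast : ∀ n : ℤ, |(n : ℝ)| ≤ K → n ∈ Set.Icc (-⌊K⌋) ⌊K⌋ := fun n hn => by
    rw [Set.mem_Icc, ← abs_le, Int.le_floor]
    exact_mod_cast hn
  exact ⟨(x, y, z), ⟨hcast _ hx, hcast _ hy, hcast _ hz⟩, by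
    simp only
    rw [← h1, Real.log_exp]⟩

theorem exists_zmultiples_logUnits {b c d : ℤ} {θ : ℝ}
    (hθ : θ ^ 3 + b * θ ^ 2 + c * θ + d = 0)
    (hdisc : cubicDisc 1 b c d < 0) (hind : IndepPowers θ) :
    ∃ l₀ : ℝ, ∀ l ∈ logUnits b c d θ hθ, ∃ n : ℤ, l = n * l₀ := by
  have hfin := finite_logUnits_Ioo hθ hdisc hind
  obtain ⟨a, ha, hdisj⟩ : ∃ a : ℝ, 0 < a ∧
      Disjoint (logUnits b c d θ hθ : Set ℝ) (Set.Ioo 0 a) := by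
    rcases Set.eq_empty_or_nonempty ((logUnits b c d θ hθ : Set ℝ) ∩ Set.Ioo 0 1) with h | h
    · exact ⟨1, one_pos, Set.disjoint_iff_inter_eq_empty.2 h⟩
    · obtain ⟨a, ⟨ha, ha'⟩, hmin⟩ := Set.exists_min_image _ id hfin h
      refine ⟨a, ha'.1, Set.disjoint_left.2 fun l hl hl' => ?_⟩
      exact absurd (hmin l ⟨hl, hl'.1, hl'.2.trans ha'.2⟩) (not_le.2 hl'.2)
  obtain ⟨l₀, h⟩ := AddSubgroup.cyclic_of_isolated_zero ha hdisj
  refine ⟨l₀, fun l hl => ?_⟩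
  rw [h, AddSubgroup.mem_closure_singleton] at hl
  obtain ⟨n, hn⟩ := hl
  exact ⟨n, by rw [← hn, zsmul_eq_mul]⟩

theorem pow_expansion {w : ℝ} {p q r P Q : ℤ} (hw : w ^ 3 = r + q * w + p * w ^ 2)
    (hP : (P : ZMod 2) = 1) (hQ : (Q : ZMod 2) = 0) (n : ℕ) :
    ∃ A B C : ℤ, (A : ZMod 2) = 1 ∧ (B : ZMod 2) = n ∧
      (P + Q * w) ^ n = A + Q * B * w + Q ^ 2 * C * w ^ 2 := by
  induction n with
  | zero => exact ⟨1, 0, 0, by simp, by simp, by simp⟩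
  | succ n ih =>
    obtain ⟨A, B, C, hA, hB, h⟩ := ih
    refine ⟨A * P + Q ^ 3 * C * r, A + B * P + Q ^ 2 * C * q, B + C * P + Q * C * p, ?_, ?_, ?_⟩
    · push_cast
      simp [hA, hP, hQ]
    · push_cast
      simp [hA, hB, hP, hQ, add_comm]
    · rw [pow_succ, h]
      push_cast
      linear_combination (Q ^ 3 * C : ℝ) * hw

theorem two_pow_mul_pow_expansion {w : ℝ} {p q r P Q : ℤ} (hw : w ^ 3 = r + q * w + p * w ^ 2)
    (hP : (P : ZMod 2) = 1) (hQ : (Q : ZMod 2) = 0) {n : ℕ} (hn : Odd n) (m : ℕ) :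
    ∃ A B C : ℤ, (A : ZMod 2) = 1 ∧ (B : ZMod 2) = 1 ∧ (C : ZMod 2) = 1 ∧
      (P + Q * w) ^ (2 ^ (m + 1) * n) =
        A + 2 ^ (m + 1) * Q * B * w + 2 ^ m * Q ^ 2 * C * w ^ 2 := by
  have h20 : (2 : ZMod 2) = 0 := rfl
  have hw4 : w ^ 4 = p * r + (r + p * q) * w + (q + p ^ 2) * w ^ 2 := by
    linear_combination (w + p) * hw
  induction m with
  | zero =>
    obtain ⟨A, B, C, hA, hB, h⟩ := pow_expansion hw hP hQ n
    have hn' : ((n : ℕ) : ZMod 2) = 1 := by rwa [ZMod.natCast_eq_one_iff_odd]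
    rw [hn'] at hB
    obtain ⟨j, rfl⟩ : (2 : ℤ) ∣ Q := (ZMod.intCast_zmod_eq_zero_iff_dvd Q 2).1 hQ
    refine ⟨A ^ 2 + 2 * (2 * j) ^ 3 * B * C * r + (2 * j) ^ 4 * C ^ 2 * (p * r),
      A * B + (2 * j) ^ 2 * B * C * q + 4 * j ^ 3 * C ^ 2 * (r + p * q),
      2 * A * C + B ^ 2 + 2 * (2 * j) * B * C * p + (2 * j) ^ 2 * C ^ 2 * (q + p ^ 2),
      ?_, ?_, ?_, ?_⟩
    · push_cast
      simp [hA, h20]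
    · push_cast
      have h40 : (4 : ZMod 2) = 0 := rfl
      simp [hA, hB, h20, h40]
    · push_cast
      simp [hB, h20]
    · rw [show 2 ^ (0 + 1) * n = n * 2 by ring, pow_mul, h]
      push_cast
      linear_combination (2 * (2 * j) ^ 3 * B * C : ℝ) * hw + ((2 * j) ^ 4 * C ^ 2 : ℝ) * hw4
  | succ m ih =>
    obtain ⟨A, B, C, hA, hB, hC, h⟩ := ih
    obtain ⟨j, rfl⟩ : (2 : ℤ) ∣ Q := (ZMod.intCast_zmod_eq_zero_iff_dvd Q 2).1 hQ
    refine ⟨A ^ 2 + 2 * (2 ^ (m + 1) * (2 * j)) * (2 ^ m * (2 * j) ^ 2) * B * C * r +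
        (2 ^ m * (2 * j) ^ 2) ^ 2 * C ^ 2 * (p * r),
      A * B + 2 ^ m * (2 * j) ^ 2 * B * C * q + 2 * 2 ^ m * j ^ 3 * C ^ 2 * (r + p * q),
      A * C + 2 * 2 ^ m * B ^ 2 + 2 ^ (m + 1) * (2 * j) * B * C * p +
        2 * 2 ^ m * j ^ 2 * C ^ 2 * (q + p ^ 2),
      ?_, ?_, ?_, ?_⟩
    · push_cast
      simp [hA, h20]
    · push_cast
      simp [hA, hB, h20]
    · push_cast
      simp [hA, hC, h20]
    · rw [show 2 ^ (m + 1 + 1) * n = 2 ^ (m + 1) * n * 2 by ring, pow_mul, h]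
      push_cast
      linear_combination (2 * (2 ^ (m + 1) * (2 * j)) * (2 ^ m * (2 * j) ^ 2) * B * C : ℝ) * hw +
        ((2 ^ m * (2 * j) ^ 2) ^ 2 * C ^ 2 : ℝ) * hw4

theorem exists_two_pow_mul_odd {s : ℕ} (hs : Even s) (hs0 : s ≠ 0) :
    ∃ m n, Odd n ∧ s = 2 ^ (m + 1) * n := by
  obtain ⟨k, n, hn, rfl⟩ := Nat.exists_eq_two_pow_mul_odd hs0
  rcases k with _ | m
  · exact absurd hs (by simpa using hn)
  · exact ⟨m, n, hn, rfl⟩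

theorem odd_pow_ne_even_pow {w : ℝ} (hind : IndepPowers w) {p q r P Q P' Q' : ℤ}
    (hw : w ^ 3 = r + q * w + p * w ^ 2)
    (hP : (P : ZMod 2) = 1) (hQ : (Q : ZMod 2) = 0) (hQ0 : Q ≠ 0)
    (hP' : (P' : ZMod 2) = 1) (hQ' : (Q' : ZMod 2) = 0) {t s : ℕ} (ht : Odd t) (hs : Even s)
    (hs0 : s ≠ 0) : ((P' : ℝ) + Q' * w) ^ t ≠ (P + Q * w) ^ s := by
  intro heq
  obtain ⟨m, n, hn, rfl⟩ := exists_two_pow_mul_odd hs hs0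
  obtain ⟨A, B, C, -, hB, h⟩ := pow_expansion hw hP' hQ' t
  obtain ⟨A', B', C', -, hB', hC', h'⟩ := two_pow_mul_pow_expansion hw hP hQ hn m
  rw [h, h'] at heq
  obtain ⟨-, h1, h2⟩ := hind.ext (x := A) (y := Q' * B) (z := Q' ^ 2 * C) (X := A')
    (Y := 2 ^ (m + 1) * Q * B') (Z := 2 ^ m * Q ^ 2 * C') (by exact_mod_cast heq)
  have ht' : ((t : ℕ) : ZMod 2) = 1 := by rwa [ZMod.natCast_eq_one_iff_odd]
  rw [ht'] at hB
  have h3 : (2 ^ m * Q ^ 2) * (C' * B ^ 2) = (2 ^ m * Q ^ 2) * (2 * 2 ^ (m + 1) * B' ^ 2 * C) := by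
    linear_combination -B ^ 2 * h2 + C * (Q' * B + 2 ^ (m + 1) * Q * B') * h1
  have h4 := mul_left_cancel₀ (by positivity) h3
  have h5 := congrArg (Int.cast : ℤ → ZMod 2) h4
  have h20 : (2 : ZMod 2) = 0 := rfl
  push_cast at h5
  simp [hB, hC', h20] at h5

theorem pow_expansion_primitive {b c d : ℤ} {θ : ℝ} (hθ : θ ^ 3 + b * θ ^ 2 + c * θ + d = 0)
    {P Q y z : ℤ} (hP : (P : ZMod 2) = 1) (hQ : (Q : ZMod 2) = 0) (n : ℕ) :
    ∃ A Y Z : ℤ, (A : ZMod 2) = 1 ∧ (Y : ZMod 2) = n * y ∧ (Z : ZMod 2) = n * z ∧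
      (P + Q * (y * θ + z * θ ^ 2)) ^ n = A + Q * (Y * θ + Z * θ ^ 2) := by
  induction n with
  | zero => exact ⟨1, 0, 0, by simp, by simp, by simp, by simp⟩
  | succ n ih =>
    obtain ⟨A, Y, Z, hA, hY, hZ, h⟩ := ih
    refine ⟨A * P + Q ^ 2 * (-d * (y * Z + z * Y) + b * d * (z * Z)),
      A * y + P * Y + Q * (-c * (y * Z + z * Y) + (b * c - d) * (z * Z)),
      A * z + P * Z + Q * (y * Y - b * (y * Z + z * Y) + (b ^ 2 - c) * (z * Z)), ?_, ?_, ?_, ?_⟩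
    · push_cast
      simp [hA, hP, hQ]
    · push_cast
      simp only [hA, hP, hQ, hY]
      ring
    · push_cast
      simp only [hA, hP, hQ, hZ]
      ring
    · rw [pow_succ, h]
      push_cast
      linear_combination (Q ^ 2 * (z * Z * θ + (y * Z + z * Y - b * z * Z)) : ℝ) * hθ

theorem two_pow_mul_pow_expansion_primitive {b c d : ℤ} {θ : ℝ}
    (hθ : θ ^ 3 + b * θ ^ 2 + c * θ + d = 0) {P j y z : ℤ} (hP : (P : ZMod 2) = 1)
    {n : ℕ} (hn : Odd n) (m : ℕ) :
    ∃ A Y Z : ℤ, (A : ZMod 2) = 1 ∧ (Y : ZMod 2) = y + j * (z * (b * c + d)) ∧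
      (Z : ZMod 2) = z + j * (y + z * (b + c)) ∧
      (P + (2 * j) * (y * θ + z * θ ^ 2)) ^ (2 ^ (m + 1) * n) =
        A + 2 ^ (m + 1) * (2 * j) * (Y * θ + Z * θ ^ 2) := by
  have h20 : (2 : ZMod 2) = 0 := rfl
  have hsq : ∀ x : ZMod 2, x ^ 2 = x := by decide
  have hneg : ∀ x : ZMod 2, -x = x := by decide
  induction m with
  | zero =>
    obtain ⟨A, Y, Z, hA, hY, hZ, h⟩ := pow_expansion_primitive hθ (Q := 2 * j) (y := y) (z := z) hP
      (by push_cast; simp [h20]) n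
    have hn' : ((n : ℕ) : ZMod 2) = 1 := by rwa [ZMod.natCast_eq_one_iff_odd]
    rw [hn', one_mul] at hY hZ
    refine ⟨A ^ 2 + (2 * j) ^ 2 * (-d * (2 * Y * Z) + b * d * Z ^ 2),
      A * Y + j * (-c * (2 * Y * Z) + (b * c - d) * Z ^ 2),
      A * Z + j * (Y ^ 2 - b * (2 * Y * Z) + (b ^ 2 - c) * Z ^ 2), ?_, ?_, ?_, ?_⟩
    · push_cast
      simp [hA, h20]
    · push_cast
      simp only [hA, hY, hZ, h20, hsq, sub_eq_add_neg, hneg]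
      ring
    · push_cast
      simp only [hA, hY, hZ, h20, hsq, sub_eq_add_neg, hneg]
      ring
    · rw [show 2 ^ (0 + 1) * n = n * 2 by ring, pow_mul]
      push_cast at h ⊢
      rw [h]
      linear_combination ((2 * j) ^ 2 * (Z * Z * θ + (2 * Y * Z - b * Z * Z)) : ℝ) * hθ
  | succ m ih =>
    obtain ⟨A, Y, Z, hA, hY, hZ, h⟩ := ih
    refine ⟨A ^ 2 + (2 ^ (m + 1) * (2 * j)) ^ 2 * (-d * (2 * Y * Z) + b * d * Z ^ 2),
      A * Y + 2 ^ (m + 1) * j * (-c * (2 * Y * Z) + (b * c - d) * Z ^ 2),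
      A * Z + 2 ^ (m + 1) * j * (Y ^ 2 - b * (2 * Y * Z) + (b ^ 2 - c) * Z ^ 2), ?_, ?_, ?_, ?_⟩
    · push_cast
      simp [hA, h20]
    · push_cast
      simp [hA, hY, h20]
    · push_cast
      simp [hA, hZ, h20]
    · rw [show 2 ^ (m + 1 + 1) * n = 2 ^ (m + 1) * n * 2 by ring, pow_mul, h]
      push_cast
      linear_combination
        ((2 ^ (m + 1) * (2 * j)) ^ 2 * (Z * Z * θ + (2 * Y * Z - b * Z * Z)) : ℝ) * hθ

theorem proportional_mod_two {θ : ℝ} (hind : IndepPowers θ) {A A' Q Q' y z Y Z : ℤ}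
    (hQ : Q ≠ 0)
    (h : (A : ℝ) + Q * (y * θ + z * θ ^ 2) = A' + Q' * (Y * θ + Z * θ ^ 2)) :
    (y : ZMod 2) * Z = z * Y := by
  obtain ⟨-, h1, h2⟩ := hind.ext (x := A) (y := Q * y) (z := Q * z) (X := A') (Y := Q' * Y)
    (Z := Q' * Z) (by push_cast; linear_combination h)
  have h3 : Q * (y * Z) = Q * (z * Y) := by linear_combination Z * h1 - Y * h2
  exact_mod_cast congrArg (Int.cast : ℤ → ZMod 2) (mul_left_cancel₀ hQ h3)

section MonicSolutions

variable {b c d : ℤ} {θ : ℝ}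

theorem linear_mul_cofactor (hθ : θ ^ 3 + b * θ ^ 2 + c * θ + d = 0) {p : ℤ × ℤ}
    (hp : cubicFormVal 1 b c d p = 1) :
    ((p.1 : ℝ) - p.2 * θ) * ((p.1 ^ 2 + b * p.1 * p.2 + c * p.2 ^ 2) +
      (p.1 * p.2 + b * p.2 ^ 2) * θ + p.2 ^ 2 * θ ^ 2) = 1 := by
  have h : ((cubicFormVal 1 b c d p : ℤ) : ℝ) = 1 := by rw [hp]; simp
  simp only [cubicFormVal] at h
  push_cast at h
  linear_combination h - p.2 ^ 3 * hθ

theorem linear_pos (hθ : θ ^ 3 + b * θ ^ 2 + c * θ + d = 0)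
    (hdisc : cubicDisc 1 b c d < 0) {p : ℤ × ℤ} (hp : cubicFormVal 1 b c d p = 1) :
    0 < (p.1 : ℝ) - p.2 * θ := by
  have h := linear_mul_cofactor hθ hp
  refine pos_of_mul_pos_left (b := (p.1 ^ 2 + b * p.1 * p.2 + c * p.2 ^ 2 : ℝ) +
      (p.1 * p.2 + b * p.2 ^ 2) * θ + p.2 ^ 2 * θ ^ 2) (by rw [h]; exact one_pos) ?_
  nlinarith [sq_nonneg (p.1 + p.2 * (b + θ) / 2 : ℝ),
    mul_nonneg (four_mul_sub_sq_pos hθ hdisc).1.le (sq_nonneg (p.2 : ℝ))]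

theorem exists_linear_eq_exp (hθ : θ ^ 3 + b * θ ^ 2 + c * θ + d = 0)
    (hdisc : cubicDisc 1 b c d < 0) (hind : IndepPowers θ) :
    ∃ (l₀ : ℝ) (n : ℤ × ℤ → ℤ), ∀ p, cubicFormVal 1 b c d p = 1 →
      (p.1 : ℝ) - p.2 * θ = Real.exp (n p * l₀) := by
  obtain ⟨l₀, h⟩ := exists_zmultiples_logUnits hθ hdisc hind
  have key : ∀ p : ℤ × ℤ, ∃ n : ℤ, cubicFormVal 1 b c d p = 1 →
      (p.1 : ℝ) - p.2 * θ = Real.exp (n * l₀) := by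
    intro p
    by_cases hp : cubicFormVal 1 b c d p = 1
    · have hpos := linear_pos hθ hdisc hp
      obtain ⟨n, hn⟩ := h (Real.log (p.1 - p.2 * θ)) (by
        refine ⟨?_, ?_⟩
        · rw [Real.exp_log hpos]
          exact ⟨p.1, -p.2, 0, by push_cast; ring⟩
        · rw [Real.exp_neg, Real.exp_log hpos, inv_eq_of_mul_eq_one_right
            (linear_mul_cofactor hθ hp)]
          exact ⟨p.1 ^ 2 + b * p.1 * p.2 + c * p.2 ^ 2, p.1 * p.2 + b * p.2 ^ 2, p.2 ^ 2,
            by push_cast; ring⟩)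
      exact ⟨n, fun _ => by rw [← hn, Real.exp_log hpos]⟩
    · exact ⟨0, fun h => absurd h hp⟩
  choose n hn using key
  exact ⟨l₀, n, hn⟩

theorem linear_injective (hind : IndepPowers θ) {p q : ℤ × ℤ}
    (h : (p.1 : ℝ) - p.2 * θ = q.1 - q.2 * θ) : p = q := by
  obtain ⟨h1, h2, -⟩ := hind.ext (x := p.1) (y := -p.2) (z := 0) (X := q.1) (Y := -q.2) (Z := 0)
    (by push_cast; linear_combination h)
  exact Prod.ext h1 (neg_injective h2)

/-- The quotient of two solutions in the same class modulo `2`. -/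
theorem exists_div_linear_eq (hθ : θ ^ 3 + b * θ ^ 2 + c * θ + d = 0) (hind : IndepPowers θ)
    {p q : ℤ × ℤ} (hp : cubicFormVal 1 b c d p = 1) (hq : cubicFormVal 1 b c d q = 1)
    (hpq : p ≠ q) (h1 : (q.1 : ZMod 2) = p.1) (h2 : (q.2 : ZMod 2) = p.2) :
    ∃ P Q : ℤ, (P : ZMod 2) = 1 ∧ (Q : ZMod 2) = 0 ∧ Q ≠ 0 ∧
      ((q.1 : ℝ) - q.2 * θ) / (p.1 - p.2 * θ) =
        P + Q * ((p.1 + b * p.2 : ℤ) * θ + p.2 * θ ^ 2) := by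
  have hinv := linear_mul_cofactor hθ hp
  have hdiv : ((q.1 : ℝ) - q.2 * θ) / (p.1 - p.2 * θ) =
      (q.1 * (p.1 ^ 2 + b * p.1 * p.2 + c * p.2 ^ 2) + q.2 * p.2 ^ 2 * d : ℤ) +
        (q.1 * p.2 - p.1 * q.2 : ℤ) * ((p.1 + b * p.2 : ℤ) * θ + p.2 * θ ^ 2) := by
    rw [div_eq_iff (left_ne_zero_of_mul_eq_one hinv)]
    push_cast
    linear_combination (-(q.1 - q.2 * θ) : ℝ) * hinv +
      (-(q.2 * p.2 ^ 2) * (p.1 - p.2 * θ) : ℝ) * hθ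
  refine ⟨_, _, ?_, ?_, ?_, hdiv⟩
  · have h := congrArg (Int.cast : ℤ → ZMod 2) hp
    simp only [cubicFormVal] at h
    push_cast at h ⊢
    rw [h1, h2]
    linear_combination h
  · push_cast
    rw [h1, h2]
    ring
  · intro h0
    rw [h0, div_eq_iff (left_ne_zero_of_mul_eq_one hinv)] at hdiv
    generalize q.1 * (p.1 ^ 2 + b * p.1 * p.2 + c * p.2 ^ 2) + q.2 * p.2 ^ 2 * d = P at hdiv
    have h3 : q = (P * p.1, P * p.2) := linear_injective hind (by
      push_cast
      linear_combination hdiv)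
    have h4 : P ^ 3 = 1 := by
      rw [h3] at hq
      simp only [cubicFormVal] at hp hq
      linear_combination hq - P ^ 3 * hp
    have h5 : P = 1 := by
      rcases Int.isUnit_iff.1 (IsUnit.of_mul_eq_one (a := P) (P ^ 2) (by linear_combination h4)) with h | h
      · exact h
      · rw [h] at h4
        norm_num at h4
    apply hpq
    rw [h3, h5]
    simp

/-- The number `w = (x + by)θ + yθ²` attached to a solution `(x, y)` generates the order. -/
theorem solution_generator (hθ : θ ^ 3 + b * θ ^ 2 + c * θ + d = 0) (hind : IndepPowers θ)
    {p : ℤ × ℤ} (hp : cubicFormVal 1 b c d p = 1) {w : ℝ}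
    (hw : w = (p.1 + b * p.2 : ℤ) * θ + p.2 * θ ^ 2) :
    IndepPowers w ∧ ∃ r q s : ℤ, w ^ 3 = r + q * w + s * w ^ 2 := by
  obtain ⟨x, y⟩ := p
  simp only at hw
  set m := x + b * y with hm
  set A := -d * (2 * m * y) + b * d * y ^ 2 with hA
  set B := -c * (2 * m * y) + (b * c - d) * y ^ 2 with hB
  set C := m ^ 2 - b * (2 * m * y) + (b ^ 2 - c) * y ^ 2 with hC
  have hdet : m * C - y * B = 1 := by
    rw [← hp, hC, hB, hm]
    simp only [cubicFormVal]
    ring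
  have hw2 : w ^ 2 = A + B * θ + C * θ ^ 2 := by
    rw [hw, hA, hB, hC]
    push_cast
    linear_combination (y ^ 2 * θ + (2 * m * y - b * y ^ 2) : ℝ) * hθ
  constructor
  · intro i j k h
    rw [hw2, hw] at h
    obtain ⟨h1, h2, h3⟩ := hind (i + k * A) (j * m + k * B) (j * y + k * C) (by
      push_cast
      linear_combination h)
    have hj : j = 0 := by linear_combination C * h2 - B * h3 - j * hdet
    have hk : k = 0 := by linear_combination m * h3 - y * h2 - k * hdet
    subst hj hk
    simpa using h1
  · have hmem : w ∈ cubicOrder b c d θ hθ := ⟨0, m, y, by rw [hw]; push_cast; ring⟩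
    obtain ⟨A', B', C', h⟩ := pow_mem hmem 3
    refine ⟨A' - (m * C' - y * B') * A, B' * C - C' * B, m * C' - y * B', ?_⟩
    have hdet' : (m * C - y * B : ℝ) = 1 := by exact_mod_cast hdet
    rw [h, hw2, hw]
    push_cast
    linear_combination (-(B' * θ + C' * θ ^ 2) : ℝ) * hdet'

end MonicSolutions

theorem exists_odd_mul_eq_even_mul {a b : ℕ} (ha : a ≠ 0) (hb : b ≠ 0)
    (h : padicValNat 2 b < padicValNat 2 a) :
    ∃ t s : ℕ, Odd t ∧ Even s ∧ s ≠ 0 ∧ a * t = b * s := by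
  obtain ⟨i, a', ha', rfl⟩ := Nat.exists_eq_two_pow_mul_odd ha
  obtain ⟨j, b', hb', rfl⟩ := Nat.exists_eq_two_pow_mul_odd hb
  have hv : ∀ k n : ℕ, Odd n → padicValNat 2 (2 ^ k * n) = k := fun k n hn => by
    rw [padicValNat.mul (by positivity) hn.pos.ne', padicValNat.prime_pow,
      padicValNat.eq_zero_of_not_dvd hn.not_two_dvd_nat, add_zero]
  rw [hv _ _ ha', hv _ _ hb'] at h
  obtain ⟨k, rfl⟩ := Nat.exists_eq_add_of_lt h
  exact ⟨b', 2 ^ (k + 1) * a', hb', by simp [parity_simps],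
    mul_ne_zero (by positivity) ha'.pos.ne', by ring⟩

theorem exists_odd_mul_eq_odd_mul {a b : ℕ} (ha : a ≠ 0) (hb : b ≠ 0)
    (h : padicValNat 2 a = padicValNat 2 b) :
    ∃ t s : ℕ, Odd t ∧ Odd s ∧ a * t = b * s := by
  obtain ⟨i, a', ha', rfl⟩ := Nat.exists_eq_two_pow_mul_odd ha
  obtain ⟨j, b', hb', rfl⟩ := Nat.exists_eq_two_pow_mul_odd hb
  have hv : ∀ k n : ℕ, Odd n → padicValNat 2 (2 ^ k * n) = k := fun k n hn => by
    rw [padicValNat.mul (by positivity) hn.pos.ne', padicValNat.prime_pow,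
      padicValNat.eq_zero_of_not_dvd hn.not_two_dvd_nat, add_zero]
  rw [hv _ _ ha', hv _ _ hb'] at h
  subst h
  exact ⟨b', a', hb', ha', by ring⟩

theorem padicValNat_two_isosceles {a b : ℕ} (ha : a ≠ 0) (hb : b ≠ 0)
    (h : padicValNat 2 a = padicValNat 2 (a + b)) :
    padicValNat 2 (a + b) < padicValNat 2 b := by
  have hab : a + b ≠ 0 := by omega
  obtain ⟨t, s, ht, hs, h1⟩ := exists_odd_mul_eq_odd_mul ha hab h
  by_contra! hlt
  have key : ∀ t' s' : ℕ, Odd s' → (b * t' = (a + b) * s') → Even t' → False := by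
    intro t' s' hs' h2 ht'
    have h3 : (a + b) * (t * t') = (a + b) * (s * t' + s' * t) := by
      linear_combination t' * h1 + t * h2
    have h4 := Nat.eq_of_mul_eq_mul_left (by omega) h3
    have h5 : Even (s * t' + s' * t) := h4 ▸ ht'.mul_left t
    rw [Nat.even_add] at h5
    exact (Nat.not_even_iff_odd.2 (hs'.mul ht)) (h5.1 (ht'.mul_left s))
  rcases hlt.lt_or_eq with hlt | heq
  · obtain ⟨t', s', ht', hs', -, h2⟩ := exists_odd_mul_eq_even_mul hab hb hlt
    exact key s' t' ht' h2.symm hs'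
  · obtain ⟨t', s', ht', hs', h2⟩ := exists_odd_mul_eq_odd_mul hb hab heq
    have h3 : (a + b) * (t * t') = (a + b) * (s * t' + s' * t) := by
      linear_combination t' * h1 + t * h2
    have h4 := Nat.eq_of_mul_eq_mul_left (by omega) h3
    exact Nat.not_even_iff_odd.2 (ht.mul ht') (h4 ▸ (hs.mul ht').add_odd (hs'.mul ht))

theorem exp_pow_eq_of_mul_eq {l : ℝ} {i j : ℤ} {t s : ℕ} (h : i * t = j * s) :
    Real.exp (i * l) ^ t = Real.exp (j * l) ^ s := by
  have h' : (i * t : ℝ) = j * s := by exact_mod_cast h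
  rw [← Real.exp_nat_mul, ← Real.exp_nat_mul]
  congr 1
  linear_combination l * h'

section ClassesModTwo

variable {b c d : ℤ} {θ l₀ : ℝ} {n : ℤ × ℤ → ℤ}

theorem div_linear_eq_exp (hn : ∀ p, cubicFormVal 1 b c d p = 1 →
      (p.1 : ℝ) - p.2 * θ = Real.exp (n p * l₀)) {p q : ℤ × ℤ}
    (hp : cubicFormVal 1 b c d p = 1) (hq : cubicFormVal 1 b c d q = 1) :
    ((q.1 : ℝ) - q.2 * θ) / (p.1 - p.2 * θ) = Real.exp ((n q - n p : ℤ) * l₀) := by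
  rw [hn p hp, hn q hq, ← Real.exp_sub]
  push_cast
  ring_nf

/-- Congruent solutions cannot have an odd power of one quotient equal to an even power of
another. -/
theorem mul_odd_ne_mul_even (hθ : θ ^ 3 + b * θ ^ 2 + c * θ + d = 0) (hind : IndepPowers θ)
    (hn : ∀ p, cubicFormVal 1 b c d p = 1 → (p.1 : ℝ) - p.2 * θ = Real.exp (n p * l₀))
    {k l m : ℤ × ℤ} (hk : cubicFormVal 1 b c d k = 1) (hl : cubicFormVal 1 b c d l = 1)
    (hm : cubicFormVal 1 b c d m = 1) (hkl : k ≠ l) (hkm : k ≠ m)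
    (hl1 : (l.1 : ZMod 2) = k.1) (hl2 : (l.2 : ZMod 2) = k.2)
    (hm1 : (m.1 : ZMod 2) = k.1) (hm2 : (m.2 : ZMod 2) = k.2) {t s : ℕ} (ht : Odd t)
    (hs : Even s) (hs0 : s ≠ 0) : (n m - n k) * t ≠ (n l - n k) * s := by
  intro h
  obtain ⟨hw, r, q, u, hw3⟩ := solution_generator hθ hind hk rfl
  obtain ⟨P, Q, hP, hQ, hQ0, e⟩ := exists_div_linear_eq hθ hind hk hl hkl hl1 hl2
  obtain ⟨P', Q', hP', hQ', -, e'⟩ := exists_div_linear_eq hθ hind hk hm hkm hm1 hm2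
  apply odd_pow_ne_even_pow hw hw3 hP hQ hQ0 hP' hQ' ht hs hs0
  rw [← e, ← e', div_linear_eq_exp hn hk hl, div_linear_eq_exp hn hk hm]
  exact exp_pow_eq_of_mul_eq h

theorem not_three_congruent (hθ : θ ^ 3 + b * θ ^ 2 + c * θ + d = 0) (hind : IndepPowers θ)
    (hn : ∀ p, cubicFormVal 1 b c d p = 1 → (p.1 : ℝ) - p.2 * θ = Real.exp (n p * l₀))
    {k l m : ℤ × ℤ} (hk : cubicFormVal 1 b c d k = 1) (hl : cubicFormVal 1 b c d l = 1)
    (hm : cubicFormVal 1 b c d m = 1) (hkl : n k < n l) (hlm : n l < n m)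
    (hl1 : (l.1 : ZMod 2) = k.1) (hl2 : (l.2 : ZMod 2) = k.2)
    (hm1 : (m.1 : ZMod 2) = k.1) (hm2 : (m.2 : ZMod 2) = k.2) : False := by
  have hne : ∀ {p q : ℤ × ℤ}, n p < n q → p ≠ q := fun h h' => by simp [h'] at h
  obtain ⟨i, hi⟩ := Int.eq_ofNat_of_zero_le (sub_nonneg.2 hkl.le)
  obtain ⟨j, hj⟩ := Int.eq_ofNat_of_zero_le (sub_nonneg.2 hlm.le)
  have hi0 : i ≠ 0 := by omega
  have hj0 : j ≠ 0 := by omega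
  have hij0 : i + j ≠ 0 := by omega
  have hij : n m - n k = i + j := by omega
  rcases lt_trichotomy (padicValNat 2 i) (padicValNat 2 (i + j)) with h | h | h
  · obtain ⟨t, s, ht, hs, hs0, e⟩ := exists_odd_mul_eq_even_mul hij0 hi0 h
    refine mul_odd_ne_mul_even hθ hind hn hk hl hm (hne hkl) (hne (hkl.trans hlm)) hl1 hl2 hm1 hm2
      ht hs hs0 ?_
    rw [hi, hij]
    exact_mod_cast e
  · obtain ⟨t, s, ht, hs, hs0, e⟩ := exists_odd_mul_eq_even_mul hj0 hij0
      (padicValNat_two_isosceles hi0 hj0 h)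
    refine mul_odd_ne_mul_even hθ hind hn hm hk hl (hne (hkl.trans hlm)).symm (hne hlm).symm
      hm1.symm hm2.symm (hl1.trans hm1.symm) (hl2.trans hm2.symm) ht hs hs0 ?_
    have e' : (j * t : ℤ) = (i + j) * s := by exact_mod_cast e
    linear_combination -e' - t * hj + s * hij
  · obtain ⟨t, s, ht, hs, hs0, e⟩ := exists_odd_mul_eq_even_mul hi0 hij0 h
    refine mul_odd_ne_mul_even hθ hind hn hk hm hl (hne (hkl.trans hlm)) (hne hkl) hm1 hm2 hl1 hl2
      ht hs hs0 ?_
    rw [hi, hij]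
    exact_mod_cast e

/-- Two solutions are congruent modulo `2` and the first precedes the second. -/
def CongruentPair (b c d : ℤ) (n : ℤ × ℤ → ℤ) (v : ZMod 2 × ZMod 2) (p q : ℤ × ℤ) : Prop :=
  cubicFormVal 1 b c d p = 1 ∧ cubicFormVal 1 b c d q = 1 ∧
    ((p.1 : ZMod 2), (p.2 : ZMod 2)) = v ∧ ((q.1 : ZMod 2), (q.2 : ZMod 2)) = v ∧ n p < n q

theorem CongruentPair.exists_exp_eq (hθ : θ ^ 3 + b * θ ^ 2 + c * θ + d = 0)
    (hind : IndepPowers θ)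
    (hn : ∀ p, cubicFormVal 1 b c d p = 1 → (p.1 : ℝ) - p.2 * θ = Real.exp (n p * l₀))
    {v : ZMod 2 × ZMod 2} {p q : ℤ × ℤ} (h : CongruentPair b c d n v p q) :
    ∃ P j x y : ℤ, (P : ZMod 2) = 1 ∧ j ≠ 0 ∧ (x : ZMod 2) = v.1 + b * v.2 ∧
      (y : ZMod 2) = v.2 ∧
      Real.exp (((n q - n p).toNat : ℤ) * l₀) = P + (2 * j : ℤ) * (x * θ + y * θ ^ 2) := by
  obtain ⟨hp, hq, rfl, hqv, hlt⟩ := h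
  obtain ⟨h1, h2⟩ := Prod.ext_iff.1 hqv
  obtain ⟨P, Q, hP, hQ, hQ0, e⟩ := exists_div_linear_eq hθ hind hp hq
    (fun h => by simp [h] at hlt) h1 h2
  obtain ⟨j, rfl⟩ : (2 : ℤ) ∣ Q := (ZMod.intCast_zmod_eq_zero_iff_dvd Q 2).1 hQ
  refine ⟨P, j, p.1 + b * p.2, p.2, hP, right_ne_zero_of_mul hQ0, by push_cast; rfl, rfl, ?_⟩
  rw [Int.toNat_of_nonneg (sub_nonneg.2 hlt.le), ← div_linear_eq_exp hn hp hq, e]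

theorem CongruentPair.padicValNat_ne (hθ : θ ^ 3 + b * θ ^ 2 + c * θ + d = 0)
    (hind : IndepPowers θ)
    (hn : ∀ p, cubicFormVal 1 b c d p = 1 → (p.1 : ℝ) - p.2 * θ = Real.exp (n p * l₀))
    {v v' : ZMod 2 × ZMod 2} {p q p' q' : ℤ × ℤ} (hv : v ≠ 0) (hv' : v' ≠ 0) (hvv : v ≠ v')
    (h : CongruentPair b c d n v p q) (h' : CongruentPair b c d n v' p' q') :
    padicValNat 2 (n q - n p).toNat ≠ padicValNat 2 (n q' - n p').toNat := by
  intro heq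
  have hlt := h.2.2.2.2
  have hlt' := h'.2.2.2.2
  obtain ⟨t, s, ht, hs, hts⟩ := exists_odd_mul_eq_odd_mul (by omega) (by omega) heq
  obtain ⟨P, j, x, y, hP, hj, hx, hy, e⟩ := h.exists_exp_eq hθ hind hn
  obtain ⟨P', j', x', y', hP', hj', hx', hy', e'⟩ := h'.exists_exp_eq hθ hind hn
  have h20 : (2 : ZMod 2) = 0 := rfl
  obtain ⟨A, X, Y, -, hX, hY, e1⟩ := pow_expansion_primitive hθ (y := x) (z := y) hP
    (Q := 2 * j) (by push_cast; simp [h20]) t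
  obtain ⟨A', X', Y', -, hX', hY', e1'⟩ := pow_expansion_primitive hθ (y := x') (z := y') hP'
    (Q := 2 * j') (by push_cast; simp [h20]) s
  have hpow := exp_pow_eq_of_mul_eq (l := l₀) (i := (n q - n p).toNat)
    (j := (n q' - n p').toNat) (t := t) (s := s) (by exact_mod_cast hts)
  rw [e, e', e1, e1'] at hpow
  have hprop := proportional_mod_two hind (by omega) hpow
  have ht' : ((t : ℕ) : ZMod 2) = 1 := by rwa [ZMod.natCast_eq_one_iff_odd]
  have hs' : ((s : ℕ) : ZMod 2) = 1 := by rwa [ZMod.natCast_eq_one_iff_odd]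
  rw [hX, hY, hX', hY', ht', hs', hx, hy, hx', hy'] at hprop
  revert hv hv' hvv hprop
  generalize (b : ZMod 2) = b
  clear * -
  revert v v' b
  decide

theorem eq_of_mul_eq_mul_zmod_two : ∀ j x y x' y' : ZMod 2, ¬(x = 0 ∧ y = 0) →
    ¬(x' = 0 ∧ y' = 0) → ¬(x = x' ∧ y = y') →
    x * (y' + j * (x' + y')) = y * (x' + j * y') → x = x' + y' ∧ y = x' := by
  decide

theorem CongruentPair.eq_of_padicValNat_lt (hθ : θ ^ 3 + b * θ ^ 2 + c * θ + d = 0)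
    (hind : IndepPowers θ)
    (hn : ∀ p, cubicFormVal 1 b c d p = 1 → (p.1 : ℝ) - p.2 * θ = Real.exp (n p * l₀))
    (hd : (d : ZMod 2) = 1) (hbc : (b + c : ZMod 2) = 1)
    {v v' : ZMod 2 × ZMod 2} {p q p' q' : ℤ × ℤ} (hv : v ≠ 0) (hv' : v' ≠ 0) (hvv : v ≠ v')
    (h : CongruentPair b c d n v p q) (h' : CongruentPair b c d n v' p' q')
    (hlt : padicValNat 2 (n q' - n p').toNat < padicValNat 2 (n q - n p).toNat) :
    v.1 + b * v.2 = v'.1 + b * v'.2 + v'.2 ∧ v.2 = v'.1 + b * v'.2 := by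
  have hpq := h.2.2.2.2
  have hpq' := h'.2.2.2.2
  obtain ⟨t, s, ht, hs, hs0, hts⟩ := exists_odd_mul_eq_even_mul (by omega) (by omega) hlt
  obtain ⟨m, k, hk, rfl⟩ := exists_two_pow_mul_odd hs hs0
  obtain ⟨P, j, x, y, hP, hj, hx, hy, e⟩ := h.exists_exp_eq hθ hind hn
  obtain ⟨P', j', x', y', hP', hj', hx', hy', e'⟩ := h'.exists_exp_eq hθ hind hn
  have h20 : (2 : ZMod 2) = 0 := rfl
  obtain ⟨A, X, Y, -, hX, hY, e1⟩ := pow_expansion_primitive hθ (y := x) (z := y) hP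
    (Q := 2 * j) (by push_cast; simp [h20]) t
  obtain ⟨A', X', Y', -, hX', hY', e1'⟩ := two_pow_mul_pow_expansion_primitive hθ (y := x')
    (z := y') (j := j') hP' hk m
  have hpow := exp_pow_eq_of_mul_eq (l := l₀) (i := (n q - n p).toNat)
    (j := (n q' - n p').toNat) (t := t) (s := 2 ^ (m + 1) * k) (by exact_mod_cast hts)
  rw [e, e', e1] at hpow
  push_cast at hpow
  rw [e1'] at hpow
  have hprop := proportional_mod_two hind (A := A) (A' := A') (Q := 2 * j)
    (Q' := 2 ^ (m + 1) * (2 * j')) (y := X) (z := Y) (Y := X') (Z := Y') (by omega)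
    (by push_cast; exact hpow)
  have ht' : ((t : ℕ) : ZMod 2) = 1 := by rwa [ZMod.natCast_eq_one_iff_odd]
  rw [hX, hY, hX', hY', ht', hx, hy, hx', hy', hd] at hprop
  have hbc' : (b * c : ZMod 2) + 1 = 1 := by
    revert hbc
    generalize (b : ZMod 2) = b
    generalize (c : ZMod 2) = c
    clear * -
    revert b c
    decide
  rw [hbc, hbc', mul_one, one_mul, one_mul] at hprop
  have hnz : ∀ u : ZMod 2 × ZMod 2, u ≠ 0 → ¬(u.1 + b * u.2 = 0 ∧ u.2 = 0) := fun u hu h =>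
    hu (Prod.ext (by simpa [h.2] using h.1) h.2)
  have hne : ¬(v.1 + b * v.2 = v'.1 + b * v'.2 ∧ v.2 = v'.2) := fun h =>
    hvv (Prod.ext (by simpa [h.2] using h.1) h.2)
  exact eq_of_mul_eq_mul_zmod_two _ _ _ _ _ (hnz v hv) (hnz v' hv') hne hprop

theorem card_le_five_of_monic (hθ : θ ^ 3 + b * θ ^ 2 + c * θ + d = 0)
    (hind : IndepPowers θ) (hdisc : cubicDisc 1 b c d < 0) (T : Finset (ℤ × ℤ))
    (hT : ∀ p ∈ T, cubicFormVal 1 b c d p = 1) : T.card ≤ 5 := by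
  obtain ⟨l₀, n, hn⟩ := exists_linear_eq_exp hθ hdisc hind
  have hinj : ∀ p ∈ T, ∀ q ∈ T, n p = n q → p = q := fun p hp q hq h =>
    linear_injective hind (by rw [hn p (hT p hp), hn q (hT q hq), h])
  set κ : ℤ × ℤ → ZMod 2 × ZMod 2 := fun p => ((p.1 : ZMod 2), (p.2 : ZMod 2)) with hκ
  have hform : ∀ p ∈ T, (κ p).1 ^ 3 + b * (κ p).1 ^ 2 * (κ p).2 + c * (κ p).1 * (κ p).2 ^ 2 +
      d * (κ p).2 ^ 3 = 1 := fun p hp => by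
    have h := congrArg (Int.cast : ℤ → ZMod 2) (hT p hp)
    simp only [cubicFormVal] at h
    push_cast at h
    rw [← h]
    ring
  have hle : ∀ v, (T.filter (κ · = v)).card ≤ 2 := by
    intro v
    by_contra! h
    obtain ⟨x, y, z, hx, hy, hz, hxy, hxz, hyz⟩ := Finset.two_lt_card_iff.1 h
    simp only [Finset.mem_filter] at hx hy hz
    have key : ∀ k l m : ℤ × ℤ, k ∈ T ∧ κ k = v → l ∈ T ∧ κ l = v → m ∈ T ∧ κ m = v →
        n k < n l → n l < n m → False := by
      rintro k l m ⟨hk, hk'⟩ ⟨hl, hl'⟩ ⟨hm, hm'⟩ h1 h2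
      obtain ⟨e1, e2⟩ := Prod.ext_iff.1 (hl'.trans hk'.symm)
      obtain ⟨e3, e4⟩ := Prod.ext_iff.1 (hm'.trans hk'.symm)
      exact not_three_congruent hθ hind hn (hT k hk) (hT l hl) (hT m hm) h1 h2 e1 e2 e3 e4
    have n1 : n x ≠ n y := fun h => hxy (hinj _ hx.1 _ hy.1 h)
    have n2 : n x ≠ n z := fun h => hxz (hinj _ hx.1 _ hz.1 h)
    have n3 : n y ≠ n z := fun h => hyz (hinj _ hy.1 _ hz.1 h)
    rcases n1.lt_or_gt with h1 | h1 <;> rcases n2.lt_or_gt with h2 | h2 <;>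
      rcases n3.lt_or_gt with h3 | h3
    · exact key x y z hx hy hz h1 h3
    · exact key x z y hx hz hy h2 h3
    · omega
    · exact key z x y hz hx hy h2 h1
    · exact key y x z hy hx hz h1 h2
    · omega
    · exact key y z x hy hz hx h3 h2
    · exact key z y x hz hy hx h3 h1
  have hzero : (T.filter (κ · = 0)).card = 0 := by
    rw [Finset.card_eq_zero, Finset.filter_eq_empty_iff]
    intro p hp h
    have := hform p hp
    simp [h] at this
  by_contra! h6
  have hsum := Finset.card_eq_sum_card_fiberwise (f := κ) (s := T) (t := Finset.univ) (by simp)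
  have huniv : (Finset.univ : Finset (ZMod 2 × ZMod 2)) = {0, (1, 0), (0, 1), (1, 1)} := by decide
  rw [huniv, Finset.sum_insert (by decide), Finset.sum_insert (by decide),
    Finset.sum_insert (by decide), Finset.sum_singleton, hzero] at hsum
  have hpair : ∀ v : ZMod 2 × ZMod 2, v ≠ 0 → ∃ p q, p ∈ T ∧ CongruentPair b c d n v p q := by
    intro v hv
    have h1 := hle (1, 0)
    have h2 := hle (0, 1)
    have h3 := hle (1, 1)
    have hv' : v = (1, 0) ∨ v = (0, 1) ∨ v = (1, 1) := by
      revert v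
      decide
    have h4 : 1 < (T.filter (κ · = v)).card := by
      rcases hv' with rfl | rfl | rfl <;> omega
    obtain ⟨p, q, hp, hq, hpq⟩ := Finset.one_lt_card_iff.1 h4
    simp only [Finset.mem_filter] at hp hq
    rcases lt_or_gt_of_ne fun h => hpq (hinj _ hp.1 _ hq.1 h) with h | h
    · exact ⟨p, q, hp.1, hT _ hp.1, hT _ hq.1, hp.2, hq.2, h⟩
    · exact ⟨q, p, hq.1, hT _ hq.1, hT _ hp.1, hq.2, hp.2, h⟩
  obtain ⟨p₁, q₁, -, h₁⟩ := hpair (1, 0) (by decide)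
  obtain ⟨p₂, q₂, m₂, h₂⟩ := hpair (0, 1) (by decide)
  obtain ⟨p₃, q₃, m₃, h₃⟩ := hpair (1, 1) (by decide)
  have hd : (d : ZMod 2) = 1 := by
    have := hform p₂ m₂
    rw [show κ p₂ = (0, 1) from h₂.2.2.1] at this
    simpa using this
  have hbc : (b + c : ZMod 2) = 1 := by
    have := hform p₃ m₃
    rw [show κ p₃ = (1, 1) from h₃.2.2.1, hd] at this
    simp only [one_pow, mul_one] at this
    have h11 : (1 : ZMod 2) + 1 = 0 := rfl
    linear_combination this - h11
  -- two classes with larger valuation than the third one would coincide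
  have key : ∀ {u v w : ZMod 2 × ZMod 2} {p q p' q' p'' q'' : ℤ × ℤ}, u ≠ 0 → v ≠ 0 → w ≠ 0 →
      u ≠ v → u ≠ w → v ≠ w → CongruentPair b c d n u p q → CongruentPair b c d n v p' q' →
      CongruentPair b c d n w p'' q'' →
      padicValNat 2 (n q - n p).toNat < padicValNat 2 (n q' - n p').toNat →
      padicValNat 2 (n q - n p).toNat < padicValNat 2 (n q'' - n p'').toNat → False := by
    intro u v w p q p' q' p'' q'' hu hv hw huv huw hvw h h' h'' hlt hlt'
    obtain ⟨e1, e2⟩ := h'.eq_of_padicValNat_lt hθ hind hn hd hbc hv hu huv.symm h hlt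
    obtain ⟨e3, e4⟩ := h''.eq_of_padicValNat_lt hθ hind hn hd hbc hw hu huw.symm h hlt'
    have e5 : v.2 = w.2 := e2.trans e4.symm
    refine hvw (Prod.ext ?_ e5)
    linear_combination e1 - e3 - b * e5
  have n12 := h₁.padicValNat_ne hθ hind hn (by decide) (by decide) (by decide) h₂
  have n13 := h₁.padicValNat_ne hθ hind hn (by decide) (by decide) (by decide) h₃
  have n23 := h₂.padicValNat_ne hθ hind hn (by decide) (by decide) (by decide) h₃
  rcases n12.lt_or_gt with i | i
  · rcases n13.lt_or_gt with j | j
    · exact key (by decide) (by decide) (by decide) (by decide) (by decide) (by decide) h₁ h₂ h₃ i j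
    · exact key (by decide) (by decide) (by decide) (by decide) (by decide) (by decide) h₃ h₁ h₂ j
        (j.trans i)
  · rcases n23.lt_or_gt with j | j
    · exact key (by decide) (by decide) (by decide) (by decide) (by decide) (by decide) h₂ h₁ h₃ i j
    · exact key (by decide) (by decide) (by decide) (by decide) (by decide) (by decide) h₃ h₁ h₂
        (j.trans i) j

end ClassesModTwo

/-- The coefficients of `F(x₀U + x₁V, y₀U + y₁V)` satisfy `D = (x₀y₁ - x₁y₀)⁶ D(F)`. -/
theorem cubicDisc_substitution (a b c d x₀ y₀ x₁ y₁ : ℤ) :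
    cubicDisc (a * x₀ ^ 3 + b * x₀ ^ 2 * y₀ + c * x₀ * y₀ ^ 2 + d * y₀ ^ 3)
      (3 * a * x₀ ^ 2 * x₁ + b * (x₀ ^ 2 * y₁ + 2 * x₀ * x₁ * y₀) +
        c * (2 * x₀ * y₀ * y₁ + x₁ * y₀ ^ 2) + 3 * d * y₀ ^ 2 * y₁)
      (3 * a * x₀ * x₁ ^ 2 + b * (2 * x₀ * x₁ * y₁ + x₁ ^ 2 * y₀) +
        c * (x₀ * y₁ ^ 2 + 2 * x₁ * y₀ * y₁) + 3 * d * y₀ * y₁ ^ 2)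
      (a * x₁ ^ 3 + b * x₁ ^ 2 * y₁ + c * x₁ * y₁ ^ 2 + d * y₁ ^ 3) =
    (x₀ * y₁ - x₁ * y₀) ^ 6 * cubicDisc a b c d := by
  simp only [cubicDisc]
  ring

theorem exists_cubic_root (b c d : ℝ) : ∃ θ : ℝ, θ ^ 3 + b * θ ^ 2 + c * θ + d = 0 := by
  set M := 1 + |b| + |c| + |d| with hM
  have hd := abs_le.1 (le_refl |d|)
  have h1 : 1 ≤ M := by linarith [abs_nonneg b, abs_nonneg c, abs_nonneg d]
  have h2 : M ≤ M ^ 2 := by nlinarith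
  have h3 : M ^ 3 = M ^ 2 + |b| * M ^ 2 + |c| * M ^ 2 + |d| * M ^ 2 := by
    rw [pow_succ]
    nth_rewrite 2 [hM]
    ring
  have e1 : |b * M ^ 2| ≤ |b| * M ^ 2 := by rw [abs_mul, abs_of_nonneg (sq_nonneg M)]
  have e2 : |c * M| ≤ |c| * M ^ 2 := by
    rw [abs_mul, abs_of_nonneg (zero_le_one.trans h1)]
    gcongr
  have e3 : |d| ≤ |d| * M ^ 2 := le_mul_of_one_le_right (abs_nonneg d) (h1.trans h2)
  have hcont : ContinuousOn (fun t : ℝ => t ^ 3 + b * t ^ 2 + c * t + d) (Set.Icc (-M) M) := by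
    fun_prop
  rw [abs_le] at e1 e2
  obtain ⟨θ, -, h⟩ := intermediate_value_Icc (by linarith) hcont
    (show (0 : ℝ) ∈ _ from ⟨by nlinarith, by nlinarith⟩)
  exact ⟨θ, h⟩

open Polynomial in
theorem indepPowers_of_no_root {b c d : ℤ} {θ : ℝ} (hθ : θ ^ 3 + b * θ ^ 2 + c * θ + d = 0)
    (hroot : ∀ t : ℚ, t ^ 3 + b * t ^ 2 + c * t + d ≠ 0) : IndepPowers θ := by
  set f : ℚ[X] := C 1 * X ^ 3 + C (b : ℚ) * X ^ 2 + C (c : ℚ) * X + C (d : ℚ) with hf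
  have hdeg : f.natDegree = 3 := natDegree_cubic one_ne_zero
  have hmonic : f.Monic := by
    rw [Monic, hf, leadingCoeff_cubic one_ne_zero]
  have hirr : Irreducible f := by
    rw [hmonic.irreducible_iff_roots_eq_zero_of_degree_le_three (by omega) (by omega),
      Multiset.eq_zero_iff_forall_notMem]
    intro t ht
    apply hroot t
    have := (mem_roots'.1 ht).2
    simpa [hf] using this
  have hmin : f = minpoly ℚ θ := minpoly.eq_of_irreducible_of_monic hirr (by simpa [hf] using hθ)
    hmonic
  intro x y z h
  set g : ℚ[X] := C (z : ℚ) * X ^ 2 + C (y : ℚ) * X + C (x : ℚ) with hg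
  have hg0 : g = 0 := by
    by_contra hne
    have h1 := natDegree_le_natDegree (minpoly.degree_le_of_ne_zero ℚ θ hne (by
      simp [hg]
      linear_combination h))
    rw [← hmin, hdeg] at h1
    have h2 : g.natDegree ≤ 2 := natDegree_quadratic_le
    omega
  have h0 := congrArg (coeff · 0) hg0
  have h1 := congrArg (coeff · 1) hg0
  have h2 := congrArg (coeff · 2) hg0
  simp [hg, coeff_X, coeff_X_pow, coeff_C, -map_intCast] at h0 h1 h2
  exact ⟨h0, h1, h2⟩

open MvPolynomial in
theorem form_ne_zero_of_irreducible {a b c d : ℤ}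
    (hirr : Irreducible
      (C (a : ℚ) * X 0 ^ 3 + C (b : ℚ) * X 0 ^ 2 * X 1 + C (c : ℚ) * X 0 * X 1 ^ 2 +
        C (d : ℚ) * X 1 ^ 3 : MvPolynomial (Fin 2) ℚ))
    {α β : ℚ} (h : α ≠ 0 ∨ β ≠ 0) :
    a * α ^ 3 + b * α ^ 2 * β + c * α * β ^ 2 + d * β ^ 3 ≠ 0 := by
  intro h0
  have key : ∀ g₁ g₂ : MvPolynomial (Fin 2) ℚ, eval (fun _ => 0) g₁ = 0 →
      eval (fun _ => 0) g₂ = 0 →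
      (C (a : ℚ) * X 0 ^ 3 + C (b : ℚ) * X 0 ^ 2 * X 1 + C (c : ℚ) * X 0 * X 1 ^ 2 +
        C (d : ℚ) * X 1 ^ 3 : MvPolynomial (Fin 2) ℚ) ≠ g₁ * g₂ := by
    intro g₁ g₂ h₁ h₂ heq
    rcases hirr.isUnit_or_isUnit heq with hu | hu
    · exact (hu.map (eval fun _ => (0 : ℚ))).ne_zero h₁
    · exact (hu.map (eval fun _ => (0 : ℚ))).ne_zero h₂
  by_cases hβ : β = 0
  · have hα : α ≠ 0 := by simpa [hβ] using h
    have ha : (a : ℚ) = 0 := by simpa [hβ, hα] using h0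
    refine key (X 1) (C (b : ℚ) * X 0 ^ 2 + C (c : ℚ) * X 0 * X 1 + C (d : ℚ) * X 1 ^ 2)
      (by simp) (by simp) ?_
    rw [ha, C_0]
    ring
  · obtain ⟨r, rfl⟩ : ∃ r, α = r * β := ⟨α / β, by field_simp⟩
    have hr : (d : ℚ) = -(a * r ^ 3 + b * r ^ 2 + c * r) := by
      have : β ^ 3 * (a * r ^ 3 + b * r ^ 2 + c * r + d) = 0 := by linear_combination h0
      have := (mul_eq_zero.1 this).resolve_left (pow_ne_zero 3 hβ)
      linear_combination this
    refine key (X 0 - C r * X 1) (C (a : ℚ) * X 0 ^ 2 + C (b + a * r : ℚ) * X 0 * X 1 +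
      C (c + (b + a * r) * r : ℚ) * X 1 ^ 2) (by simp) (by simp) ?_
    rw [hr]
    simp only [C_add, C_mul, C_neg, C_pow]
    ring

theorem card_le_five {a b c d : ℤ}
    (hirr : Irreducible
      (MvPolynomial.C (a : ℚ) * MvPolynomial.X 0 ^ 3 +
        MvPolynomial.C (b : ℚ) * MvPolynomial.X 0 ^ 2 * MvPolynomial.X 1 +
        MvPolynomial.C (c : ℚ) * MvPolynomial.X 0 * MvPolynomial.X 1 ^ 2 +
        MvPolynomial.C (d : ℚ) * MvPolynomial.X 1 ^ 3 : MvPolynomial (Fin 2) ℚ))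
    (hdisc : cubicDisc a b c d < 0) (T : Finset (ℤ × ℤ))
    (hT : ∀ p ∈ T, cubicFormVal a b c d p = 1) : T.card ≤ 5 := by
  rcases T.eq_empty_or_nonempty with rfl | ⟨⟨x₀, y₀⟩, hp⟩
  · simp
  have hp1 := hT _ hp
  simp only [cubicFormVal] at hp1
  obtain ⟨y₁, x₁, hdet⟩ : IsCoprime x₀ y₀ :=
    ⟨a * x₀ ^ 2 + b * x₀ * y₀ + c * y₀ ^ 2, d * y₀ ^ 2, by linear_combination hp1⟩
  obtain ⟨x₁, rfl⟩ : ∃ x, x₁ = -x := ⟨-x₁, by ring⟩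
  have hdet' : x₀ * y₁ - x₁ * y₀ = 1 := by linear_combination hdet
  have hD := cubicDisc_substitution a b c d x₀ y₀ x₁ y₁
  rw [hp1, hdet', one_pow, one_mul] at hD
  set b' := 3 * a * x₀ ^ 2 * x₁ + b * (x₀ ^ 2 * y₁ + 2 * x₀ * x₁ * y₀) +
        c * (2 * x₀ * y₀ * y₁ + x₁ * y₀ ^ 2) + 3 * d * y₀ ^ 2 * y₁ with hb'
  set c' := 3 * a * x₀ * x₁ ^ 2 + b * (2 * x₀ * x₁ * y₁ + x₁ ^ 2 * y₀) +
        c * (x₀ * y₁ ^ 2 + 2 * x₁ * y₀ * y₁) + 3 * d * y₀ * y₁ ^ 2 with hc'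
  set d' := a * x₁ ^ 3 + b * x₁ ^ 2 * y₁ + c * x₁ * y₁ ^ 2 + d * y₁ ^ 3 with hd'
  obtain ⟨θ, hθ⟩ := exists_cubic_root b' c' d'
  have hroot : ∀ t : ℚ, t ^ 3 + b' * t ^ 2 + c' * t + d' ≠ 0 := by
    intro t h
    have hdq : (x₀ * y₁ - x₁ * y₀ : ℚ) = 1 := by exact_mod_cast hdet'
    have hpq : (a * x₀ ^ 3 + b * x₀ ^ 2 * y₀ + c * x₀ * y₀ ^ 2 + d * y₀ ^ 3 : ℚ) = 1 := by
      exact_mod_cast hp1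
    refine form_ne_zero_of_irreducible hirr (α := x₀ * t + x₁) (β := y₀ * t + y₁) ?_ ?_
    · by_contra! h2
      have : (1 : ℚ) = 0 := by linear_combination -hdq + x₀ * h2.2 - y₀ * h2.1
      exact one_ne_zero this
    · rw [hb', hc', hd'] at h
      push_cast at h
      linear_combination h + t ^ 3 * hpq
  have hind := indepPowers_of_no_root hθ hroot
  set φ : ℤ × ℤ → ℤ × ℤ := fun p => (y₁ * p.1 - x₁ * p.2, x₀ * p.2 - y₀ * p.1) with hφ
  have hback : ∀ p : ℤ × ℤ, p = (x₀ * (φ p).1 + x₁ * (φ p).2, y₀ * (φ p).1 + y₁ * (φ p).2) := by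
    intro p
    ext
    · simp only [hφ]
      linear_combination -p.1 * hdet'
    · simp only [hφ]
      linear_combination -p.2 * hdet'
  have hinj : Function.Injective φ := fun p q h => by rw [hback p, hback q, h]
  rw [← Finset.card_image_of_injective T hinj]
  refine card_le_five_of_monic hθ hind (by rw [hD]; exact hdisc) _ ?_
  intro q hq
  obtain ⟨p, hpT, rfl⟩ := Finset.mem_image.1 hq
  have h := hT p hpT
  rw [hback p] at h
  generalize φ p = q at h ⊢
  simp only [cubicFormVal] at h ⊢
  rw [hb', hc', hd']
  linear_combination h - q.1 ^ 3 * hp1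

/-- A cubic Thue equation `F(U,V) = ±1`, with `F` irreducible over `ℚ` of negative
discriminant, has at most `5` integer solutions (counting `(u,v)` and `(-u,-v)` as
one solution). -/
theorem cubic_thue_eq_negative_disc_at_most_five_solutions (a b c d : ℤ)
    (hirr : Irreducible
      (MvPolynomial.C (a : ℚ) * MvPolynomial.X 0 ^ 3 +
        MvPolynomial.C (b : ℚ) * MvPolynomial.X 0 ^ 2 * MvPolynomial.X 1 +
        MvPolynomial.C (c : ℚ) * MvPolynomial.X 0 * MvPolynomial.X 1 ^ 2 +
        MvPolynomial.C (d : ℚ) * MvPolynomial.X 1 ^ 3 : MvPolynomial (Fin 2) ℚ))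
    (hdisc : cubicDisc a b c d < 0) :
    Finite (Quot (pmRelCubic a b c d)) ∧ Nat.card (Quot (pmRelCubic a b c d)) ≤ 5 := by
  set S : Set (ℤ × ℤ) := {p | cubicFormVal a b c d p = 1} with hS
  have hcard : S.encard ≤ 5 := by
    by_contra! h
    obtain ⟨T, hTS, hT⟩ := Set.exists_subset_encard_eq (Order.add_one_le_of_lt h)
    have hTfin : T.Finite := Set.finite_of_encard_eq_coe (k := 6) (by rw [hT]; rfl)
    have h5 := card_le_five hirr hdisc hTfin.toFinset fun p hp => hTS (hTfin.mem_toFinset.1 hp)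
    rw [hTfin.encard_eq_coe_toFinset_card] at hT
    have : hTfin.toFinset.card = 6 := by exact_mod_cast hT
    omega
  have hfin : S.Finite := Set.finite_of_encard_le_coe (k := 5) hcard
  have : Finite S := hfin
  let ψ : S → Quot (pmRelCubic a b c d) := fun p => Quot.mk _ ⟨p.1, Or.inl p.2⟩
  have hψ : Function.Surjective ψ := by
    intro y
    obtain ⟨⟨p, hp⟩, rfl⟩ := Quot.exists_rep y
    rcases hp with hp | hp
    · exact ⟨⟨p, hp⟩, rfl⟩
    · have hp' : cubicFormVal a b c d (-p) = 1 := by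
        simp only [cubicFormVal, Prod.fst_neg, Prod.snd_neg] at hp ⊢
        linear_combination -hp
      exact ⟨⟨-p, hp'⟩, Quot.sound (Or.inr rfl)⟩
  refine ⟨Finite.of_surjective ψ hψ, (Nat.card_le_card_of_surjective ψ hψ).trans ?_⟩
  rw [Nat.card_coe_set_eq]
  exact_mod_cast hfin.cast_ncard_eq.trans_le hcard
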